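/- Let R_1 and R_2 be reduced words in the alphabet {1,…,n−1}. Then the Bott–Samelson distributions 𝔓_{R_1,q} and 𝔓_{R_2,q} are equal as rational functions of q — that is, wt_{R_1}(x)·(1+q)^{L(R_2)} = wt_{R_2}(x)·(1+q)^{L(R_1)} in ℤ[q] for every x ∈ S_n — if and only if R_1 and R_2 are commutation-equivalent. -/

import Mathlib

open scoped Classical

namespace BSDist

/-- The simple transposition `s i` (1-indexed): it swaps the values `i` and `i+1`
of `{1,…,n}`, i.e. the elements `i-1` and `i` of `Fin n`.  Out-of-range letters
give the identity. -/
def sTr (n : ℕ) (i : ℕ) : Equiv.Perm (Fin n) :=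
  if h : 1 ≤ i ∧ i < n then Equiv.swap ⟨i - 1, by omega⟩ ⟨i, h.2⟩ else 1

/-- The product `w(R) = s_{i₁} ⋯ s_{i_L}` of a word. -/
def wprod (n : ℕ) (R : List ℕ) : Equiv.Perm (Fin n) := (R.map (sTr n)).prod

/-- The Coxeter length of a permutation: its number of inversions. -/
def len {n : ℕ} (w : Equiv.Perm (Fin n)) : ℕ :=
  (Finset.univ.filter (fun p : Fin n × Fin n => p.1 < p.2 ∧ w p.2 < w p.1)).card

/-- A word over the alphabet `{1,…,n-1}`. -/
def Alphabet (n : ℕ) (R : List ℕ) : Prop := ∀ i ∈ R, 1 ≤ i ∧ i < n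

/-- `R` is a reduced word (over the alphabet `{1,…,n-1}`). -/
def IsReducedWord (n : ℕ) (R : List ℕ) : Prop :=
  Alphabet n R ∧ R.length = len (wprod n R)

/-- `R` is a reduced word for `w`. -/
def IsReducedWordFor (n : ℕ) (R : List ℕ) (w : Equiv.Perm (Fin n)) : Prop :=
  IsReducedWord n R ∧ wprod n R = w

/-- The weight `wt_R : S_n → ℤ[q]`, defined by the recursion
`wt_∅(e) = 1`, `wt_∅(x) = 0` for `x ≠ e`, and for an appended letter `i`:
`wt_{Ri}(x) = wt_R(x) + wt_R(x sᵢ)` if `ℓ(x sᵢ) > ℓ(x)`, and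
`wt_{Ri}(x) = q·wt_R(x) + q·wt_R(x sᵢ)` if `ℓ(x sᵢ) < ℓ(x)`. -/
noncomputable def wt (n : ℕ) (R : List ℕ) : Equiv.Perm (Fin n) → Polynomial ℤ :=
  R.foldl
    (fun f i x =>
      if len x < len (x * sTr n i) then f x + f (x * sTr n i)
      else Polynomial.X * f x + Polynomial.X * f (x * sTr n i))
    (fun x => if x = 1 then 1 else 0)

/-- A single commutation move: replace a consecutive factor `ij` by `ji` where
`|i - j| > 1`. -/
def CommMove (R R' : List ℕ) : Prop :=
  ∃ (A B : List ℕ) (i j : ℕ), (i + 1 < j ∨ j + 1 < i) ∧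
    R = A ++ [i, j] ++ B ∧ R' = A ++ [j, i] ++ B

/-- Commutation equivalence: a finite sequence of commutation moves. -/
def CommEquiv (R R' : List ℕ) : Prop := Relation.ReflTransGen CommMove R R'

/-- A single braid move: replace a consecutive factor `k(k+1)k` by `(k+1)k(k+1)`. -/
def BraidMove (R R' : List ℕ) : Prop :=
  ∃ (A B : List ℕ) (k : ℕ),
    R = A ++ [k, k + 1, k] ++ B ∧ R' = A ++ [k + 1, k, k + 1] ++ B

/-- The Demazure product of a word, computed left to right:
`w ∗ sᵢ = w sᵢ` if `ℓ(w sᵢ) > ℓ(w)`, and `w ∗ sᵢ = w` otherwise. -/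
def dem (n : ℕ) (R : List ℕ) : Equiv.Perm (Fin n) :=
  R.foldl (fun w i => if len w < len (w * sTr n i) then w * sTr n i else w) 1

/-- `app w t` is the value `w(t)` in 1-indexed one-line notation:
positions and values both run through `{1,…,n}`. -/
def app {n : ℕ} (w : Equiv.Perm (Fin n)) (t : ℕ) : ℕ :=
  if h : 1 ≤ t ∧ t ≤ n then ((w ⟨t - 1, by omega⟩ : Fin n) : ℕ) + 1 else 0

/-- `posOf x t = x⁻¹(t)`, the (1-indexed) position of the value `t` in `x`. -/
def posOf {n : ℕ} (x : Equiv.Perm (Fin n)) (t : ℕ) : ℕ := app x⁻¹ t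

/-- The longest element `w₀` of `S_n` (the order-reversing permutation). -/
def w0 (n : ℕ) : Equiv.Perm (Fin n) := ⟨Fin.rev, Fin.rev, Fin.rev_rev, Fin.rev_rev⟩

/-- The value pair `(a,b)` (with `a < b`) is an inversion of `x`:
`x⁻¹(a) > x⁻¹(b)`. -/
def IsInversion {n : ℕ} (x : Equiv.Perm (Fin n)) (a b : ℕ) : Prop :=
  posOf x b < posOf x a

/-- `tau R a b` is the first time `k` at which the pair `(a,b)` is an inversion
of the prefix product `s_{i₁} ⋯ s_{i_k}`. -/
noncomputable def tau (n : ℕ) (R : List ℕ) (a b : ℕ) : ℕ :=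
  sInf {k | IsInversion (wprod n (R.take k)) a b}

/-- `T_R(a,b,c) = +1` if `τ_R(a,b) < τ_R(b,c)` and `-1` otherwise. -/
noncomputable def T (n : ℕ) (R : List ℕ) (a b c : ℕ) : ℤ :=
  if tau n R a b < tau n R b c then 1 else -1

/-- `Supp(x) = {t : pos_x(t) ≠ pos_{w₀}(t)}`. -/
noncomputable def Supp (n : ℕ) (x : Equiv.Perm (Fin n)) : Finset ℕ :=
  (Finset.Icc 1 n).filter (fun t => posOf x t ≠ posOf (w0 n) t)

/-- `Fwd(x) = {t : pos_x(t) < pos_{w₀}(t)}`. -/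
noncomputable def Fwd (n : ℕ) (x : Equiv.Perm (Fin n)) : Finset ℕ :=
  (Finset.Icc 1 n).filter (fun t => posOf x t < posOf (w0 n) t)

/-- `Bwd(x) = {t : pos_x(t) > pos_{w₀}(t)}`. -/
noncomputable def Bwd (n : ℕ) (x : Equiv.Perm (Fin n)) : Finset ℕ :=
  (Finset.Icc 1 n).filter (fun t => posOf (w0 n) t < posOf x t)

/-- `D_R(x)`: the coefficient of `q^{N-1}` in `wt_R(x)`, where `N = n(n-1)/2`. -/
noncomputable def D (n : ℕ) (R : List ℕ) (x : Equiv.Perm (Fin n)) : ℤ :=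
  (wt n R x).coeff (n * (n - 1) / 2 - 1)

/-- `σ_b(x) = sign(pos_x(b) − pos_{w₀}(b)) ∈ {−1,0,+1}`. -/
noncomputable def sigmaVal (n : ℕ) (b : ℕ) (x : Equiv.Perm (Fin n)) : ℤ :=
  Int.sign ((posOf x b : ℤ) - (posOf (w0 n) b : ℤ))

/-- `Θ_R(a,b,c) = Σ_{x : Supp(x) = [a,c]} D_R(x)·σ_b(x)`. -/
noncomputable def Theta (n : ℕ) (R : List ℕ) (a b c : ℕ) : ℤ :=
  ∑ x ∈ Finset.univ.filter (fun x : Equiv.Perm (Fin n) => Supp n x = Finset.Icc a c),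
    D n R x * sigmaVal n b x

end BSDist

namespace BSDist

def ev {n : ℕ} (y : Equiv.Perm (Fin n)) (q : ℕ) : ℕ :=
  if h : q < n then (y ⟨q, h⟩ : ℕ) else q

theorem ev_mul {n : ℕ} (x y : Equiv.Perm (Fin n)) (q : ℕ) : ev (x * y) q = ev x (ev y q) := by
  unfold ev
  by_cases h : q < n <;> simp [h]

theorem ev_one {n : ℕ} (q : ℕ) : ev (1 : Equiv.Perm (Fin n)) q = q := by
  unfold ev
  by_cases h : q < n <;> simp [h]

theorem ev_inv_ev {n : ℕ} (x : Equiv.Perm (Fin n)) (q : ℕ) : ev x⁻¹ (ev x q) = q := by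
  rw [← ev_mul]; simp [ev_one]

theorem ev_ev_inv {n : ℕ} (x : Equiv.Perm (Fin n)) (q : ℕ) : ev x (ev x⁻¹ q) = q := by
  rw [← ev_mul]; simp [ev_one]

theorem ev_inj {n : ℕ} (x : Equiv.Perm (Fin n)) {p q : ℕ} (h : ev x p = ev x q) : p = q := by
  rw [← ev_inv_ev x p, h, ev_inv_ev]

theorem ev_lt {n : ℕ} (x : Equiv.Perm (Fin n)) {q : ℕ} (h : q < n) : ev x q < n := by
  unfold ev; simp [h]

theorem ev_ge {n : ℕ} (x : Equiv.Perm (Fin n)) {q : ℕ} (h : n ≤ q) : ev x q = q := by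
  unfold ev; simp [Nat.not_lt.mpr h]

theorem ev_ext {n : ℕ} {x y : Equiv.Perm (Fin n)} (h : ∀ q, ev x q = ev y q) : x = y := by
  ext q
  have := h q
  unfold ev at this
  simpa using this

theorem ev_s {n i : ℕ} (h1 : 1 ≤ i) (h2 : i < n) (q : ℕ) :
    ev (sTr n i) q = if q = i - 1 then i else if q = i then i - 1 else q := by
  unfold ev sTr
  have h3 : i - 1 ≠ i := by omega
  by_cases h : q < n
  · simp only [h, h1, h2, and_self, dif_pos, Equiv.swap_apply_def, Fin.mk.injEq]
    split_ifs <;> rfl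
  · simp only [h, dif_neg, not_false_eq_true]
    split_ifs <;> omega

theorem sTr_mul_self (n i : ℕ) : sTr n i * sTr n i = 1 := by
  unfold sTr; split_ifs <;> simp

theorem mul_s_s {n i : ℕ} (x : Equiv.Perm (Fin n)) : x * sTr n i * sTr n i = x := by
  rw [mul_assoc, sTr_mul_self, mul_one]

theorem sTr_inv (n i : ℕ) : (sTr n i)⁻¹ = sTr n i := by
  rw [inv_eq_iff_mul_eq_one, sTr_mul_self]

theorem len_up {n i : ℕ} (h1 : 1 ≤ i) (h2 : i < n) (x : Equiv.Perm (Fin n))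
    (h : ev x (i-1) < ev x i) : len (x * sTr n i) = len x + 1 := by
  have h0 : i - 1 < n := by omega
  set P : Fin n × Fin n := (⟨i-1, h0⟩, ⟨i, h2⟩) with hP
  set s := sTr n i with hs
  have sv : ∀ q : Fin n, (s q : ℕ) = if (q:ℕ) = i - 1 then i else if (q:ℕ) = i then i - 1 else q := by
    intro q
    have := ev_s h1 h2 (q:ℕ)
    unfold ev at this
    simpa using this
  have hss : ∀ q, s (s q) = q := by
    intro q
    have := sTr_mul_self n i
    rw [← hs] at this
    rw [← Equiv.Perm.mul_apply, this]; rfl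
  have hx : x ⟨i-1, h0⟩ < x ⟨i, h2⟩ := by
    unfold ev at h; simpa [h0, h2] using h
  have s1 : s ⟨i-1, h0⟩ = ⟨i, h2⟩ := by
    apply Fin.ext; rw [sv]; simp
  have s2 : s ⟨i, h2⟩ = ⟨i-1, h0⟩ := by
    rw [← s1, hss]
  have key : (Finset.univ.filter (fun p : Fin n × Fin n => p.1 < p.2 ∧ (x * s) p.2 < (x * s) p.1))
      = insert P ((Finset.univ.filter (fun p : Fin n × Fin n => p.1 < p.2 ∧ x p.2 < x p.1)).map
        (Equiv.prodCongr s s).toEmbedding) := by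
    ext ⟨p, q⟩
    rw [Finset.mem_filter, Finset.mem_insert, Finset.mem_map_equiv, Finset.mem_filter]
    simp only [Finset.mem_univ, true_and, Equiv.Perm.mul_apply, hP, Prod.mk.injEq]
    have e : (Equiv.prodCongr s s).symm (p, q) = (s p, s q) := by
      rw [Equiv.symm_apply_eq]; simp [hss]
    rw [e]
    have hp := sv p
    have hq := sv q
    by_cases hc : p = ⟨i-1, h0⟩ ∧ q = ⟨i, h2⟩
    · obtain ⟨rfl, rfl⟩ := hc
      simp only [s1, s2, hx, and_true, true_or, iff_true, and_self]
      exact Fin.mk_lt_mk.mpr (by omega)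
    · simp only [hc, false_or]
      by_cases hd : q = ⟨i-1, h0⟩ ∧ p = ⟨i, h2⟩
      · obtain ⟨rfl, rfl⟩ := hd
        simp only [s1, s2]
        constructor
        · rintro ⟨a, b⟩
          exact absurd a (by simp)
        · rintro ⟨a, b⟩
          exact absurd b (by simpa using hx.le)
      · have : p < q ↔ s p < s q := by
          simp only [Fin.ext_iff] at hc hd
          simp only [Fin.lt_def, hp, hq]
          split_ifs <;> omega
        simp only [this]
  unfold len
  rw [key, Finset.card_insert_of_notMem, Finset.card_map]
  simp only [Finset.mem_map_equiv, Finset.mem_filter, Finset.mem_univ, true_and, hP]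
  have e : (Equiv.prodCongr s s).symm (⟨i-1, h0⟩, ⟨i, h2⟩) = (⟨i, h2⟩, ⟨i-1, h0⟩) := by
    rw [Equiv.symm_apply_eq]; simp [s1, s2]
  rw [e]
  rintro ⟨a, b⟩
  have := Fin.mk_lt_mk.mp a
  omega

theorem ev_mul_s1 {n i : ℕ} (h1 : 1 ≤ i) (h2 : i < n) (x : Equiv.Perm (Fin n)) :
    ev (x * sTr n i) (i-1) = ev x i := by
  rw [ev_mul, ev_s h1 h2]; simp

theorem ev_mul_s2 {n i : ℕ} (h1 : 1 ≤ i) (h2 : i < n) (x : Equiv.Perm (Fin n)) :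
    ev (x * sTr n i) i = ev x (i-1) := by
  have : i ≠ i - 1 := by omega
  rw [ev_mul, ev_s h1 h2]; simp [this]

theorem ev_mul_s3 {n i : ℕ} (h1 : 1 ≤ i) (h2 : i < n) (x : Equiv.Perm (Fin n)) {q : ℕ}
    (hq : q ≠ i - 1) (hq' : q ≠ i) :
    ev (x * sTr n i) q = ev x q := by
  rw [ev_mul, ev_s h1 h2]; simp [hq, hq']

theorem asc_iff {n i : ℕ} (h1 : 1 ≤ i) (h2 : i < n) (x : Equiv.Perm (Fin n)) :
    len x < len (x * sTr n i) ↔ ev x (i-1) < ev x i := by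
  constructor
  · intro h
    by_contra hc
    have hne : ev x (i-1) ≠ ev x i := fun h => by have := ev_inj x h; omega
    have := len_up h1 h2 (x * sTr n i) (by rw [ev_mul_s1 h1 h2, ev_mul_s2 h1 h2]; omega)
    rw [mul_s_s] at this
    omega
  · intro h
    have := len_up h1 h2 x h
    omega

theorem len_le {n i : ℕ} (h1 : 1 ≤ i) (h2 : i < n) (x : Equiv.Perm (Fin n)) :
    len (x * sTr n i) ≤ len x + 1 := by
  by_cases h : ev x (i-1) < ev x i
  · exact (len_up h1 h2 x h).le
  · rw [← asc_iff h1 h2] at h; omega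

/-- one Demazure step -/
noncomputable def dm (n : ℕ) (z : Equiv.Perm (Fin n)) (i : ℕ) : Equiv.Perm (Fin n) :=
  if len z < len (z * sTr n i) then z * sTr n i else z

noncomputable def dmz (n : ℕ) (z : Equiv.Perm (Fin n)) (B : List ℕ) : Equiv.Perm (Fin n) :=
  B.foldl (dm n) z

theorem wprod_append (n : ℕ) (A B : List ℕ) : wprod n (A ++ B) = wprod n A * wprod n B := by
  simp [wprod]

theorem wprod_cons (n i : ℕ) (B : List ℕ) : wprod n (i :: B) = sTr n i * wprod n B := by
  simp [wprod]

theorem wprod_nil (n : ℕ) : wprod n [] = 1 := by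
  simp [wprod]

/-- every letter of `B` is an ascent when started at `y` -/
def Asc (n : ℕ) (y : Equiv.Perm (Fin n)) (B : List ℕ) : Prop :=
  ∀ A i C, B = A ++ i :: C →
    1 ≤ i ∧ i < n ∧ ev (y * wprod n A) (i-1) < ev (y * wprod n A) i

theorem Asc.cons {n i : ℕ} {y : Equiv.Perm (Fin n)} {B : List ℕ} (h : Asc n y (i :: B)) :
    (1 ≤ i ∧ i < n ∧ ev y (i-1) < ev y i) ∧ Asc n (y * sTr n i) B := by
  constructor
  · have := h [] i B rfl
    simpa [wprod_nil] using this
  · intro A j C hB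
    have := h (i :: A) j C (by simp [hB])
    simpa [wprod_cons, mul_assoc] using this

theorem Asc.split {n : ℕ} {y : Equiv.Perm (Fin n)} {A B : List ℕ} (h : Asc n y (A ++ B)) :
    Asc n y A ∧ Asc n (y * wprod n A) B := by
  constructor
  · intro A' j C hB
    exact h A' j (C ++ B) (by simp [hB])
  · intro A' j C hB
    have := h (A ++ A') j C (by simp [hB])
    simpa [wprod_append, mul_assoc] using this

theorem len_wprod_le {n : ℕ} (B : List ℕ) (y : Equiv.Perm (Fin n)) (hB : Alphabet n B) :
    len (y * wprod n B) ≤ len y + B.length := by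
  induction B generalizing y with
  | nil => simp [wprod_nil]
  | cons i B ih =>
    rw [wprod_cons, ← mul_assoc]
    have hi := hB i (by simp)
    have h1 := ih (y * sTr n i) (fun j hj => hB j (by simp [hj]))
    have h2 := len_le hi.1 hi.2 y
    simp; omega

theorem len_one (n : ℕ) : len (1 : Equiv.Perm (Fin n)) = 0 := by
  unfold len
  rw [Finset.card_eq_zero, Finset.filter_eq_empty_iff]
  rintro ⟨p, q⟩ _ ⟨h1, h2⟩
  simp at h1 h2
  omega

theorem reduced_asc {n : ℕ} {R : List ℕ} (h : IsReducedWord n R) : Asc n 1 R := by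
  rintro A i C rfl
  obtain ⟨hA, hl⟩ := h
  have hi := hA i (by simp)
  refine ⟨hi.1, hi.2, ?_⟩
  rw [one_mul, ← asc_iff hi.1 hi.2]
  have h1 := len_wprod_le A 1 (fun j hj => hA j (by simp [hj]))
  have h2 := len_wprod_le C (wprod n A * sTr n i) (fun j hj => hA j (by simp [hj]))
  rw [wprod_append, wprod_cons, ← mul_assoc] at hl
  rw [one_mul, len_one] at h1
  simp at hl
  omega

theorem asc_reduced {n : ℕ} {R : List ℕ} (h : Asc n 1 R) : IsReducedWord n R := by
  have key : ∀ (B : List ℕ) (y : Equiv.Perm (Fin n)), Asc n y B →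
      len (y * wprod n B) = len y + B.length := by
    intro B
    induction B with
    | nil => simp [wprod_nil]
    | cons i B ih =>
      intro y hy
      obtain ⟨⟨a, b, c⟩, d⟩ := hy.cons
      rw [wprod_cons, ← mul_assoc, ih _ d, len_up a b y c]
      simp; omega
  constructor
  · intro i hi
    obtain ⟨A, C, rfl⟩ := List.append_of_mem hi
    have := h A i C rfl
    exact ⟨this.1, this.2.1⟩
  · have := key R 1 h
    rw [one_mul, len_one] at this
    omega

theorem inv_s {n i : ℕ} (h1 : 1 ≤ i) (h2 : i < n) (x : Equiv.Perm (Fin n)) (b : ℕ) :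
    ev (x * sTr n i)⁻¹ b = if ev x⁻¹ b = i - 1 then i else if ev x⁻¹ b = i then i - 1 else ev x⁻¹ b := by
  rw [mul_inv_rev, sTr_inv, ev_mul, ev_s h1 h2]

theorem inv_mono {n : ℕ} (B : List ℕ) (y : Equiv.Perm (Fin n)) (h : Asc n y B) {a c : ℕ}
    (hac : a < c) (hi : ev y⁻¹ c < ev y⁻¹ a) :
    ev (y * wprod n B)⁻¹ c < ev (y * wprod n B)⁻¹ a := by
  induction B generalizing y with
  | nil => simpa [wprod_nil] using hi
  | cons i B ih =>
    obtain ⟨⟨h1, h2, h3⟩, h4⟩ := h.cons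
    rw [wprod_cons, ← mul_assoc]
    apply ih _ h4
    rw [inv_s h1 h2, inv_s h1 h2]
    have e1 := ev_ev_inv y a
    have e2 := ev_ev_inv y c
    split_ifs with q1 q2 q3 q4 q5 <;> try omega
    rw [q1] at e2; rw [q3] at e1; omega

end BSDist
namespace BSDist

structure RS (j : ℕ) (f g f' g' : ℕ → ℕ) : Prop where
  f1 : f' j = f (j+1)
  f2 : f' (j+1) = f j
  f3 : ∀ q, q ≠ j → q ≠ j+1 → f' q = f q
  le : f j ≤ f (j+1)
  ne : ¬ (f j = 1 ∧ f (j+1) = 1)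
  g3 : ∀ q, q ≠ j → q ≠ j+1 → g' q = g q
  g12 : (g j ≤ g (j+1) ∧ g' j = g (j+1) ∧ g' (j+1) = g j) ∨ (g (j+1) ≤ g j ∧ g' j = g j ∧ g' (j+1) = g (j+1))

/-- `f` and `g` agree except at two positions -/
def S2 (α β γ δ : ℕ) (f g : ℕ → ℕ) : Prop :=
  ∃ p p', p < p' ∧ f p = α ∧ f p' = β ∧ g p = γ ∧ g p' = δ ∧ (∀ q, q ≠ p → q ≠ p' → f q = g q)

/-- `f` and `g` agree except at three positions -/
def S3 (α β γ α' β' γ' : ℕ) (f g : ℕ → ℕ) : Prop :=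
  ∃ p p' r, p < p' ∧ p' < r ∧ f p = α ∧ f p' = β ∧ f r = γ ∧ g p = α' ∧ g p' = β' ∧ g r = γ'
    ∧ (∀ q, q ≠ p → q ≠ p' → q ≠ r → f q = g q)

def Bd (f : ℕ → ℕ) : Prop := (∀ q, f q ≤ 2) ∧ (∀ p q, f p = 1 → f q = 1 → p = q)

theorem same_step {j : ℕ} {f g f' g' : ℕ → ℕ} (h : RS j f g f' g') (hs : ∀ q, f q = g q) :
    ∀ q, f' q = g' q := by
  obtain ⟨f1, f2, f3, le, ne, g3, g12⟩ := h
  intro q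
  have := hs j; have := hs (j+1); have := hs q
  by_cases h1 : q = j
  · subst h1; omega
  by_cases h2 : q = j + 1
  · subst h2; omega
  rw [f3 q h1 h2, g3 q h1 h2, hs]

theorem step_cases {j : ℕ} {f g f' g' : ℕ → ℕ} (h : RS j f g f' g') :
    (∃ m : ℕ → ℕ, (∀ q, f' (m q) = f q) ∧ (∀ q, g' (m q) = g q) ∧
      (∀ q q', q < q' → m q < m q' ∨ (f q ≤ f q' ∧ g q ≤ g q')) ∧ (∀ q, m (m q) = q)) ∨
    (f j < f (j+1) ∧ g (j+1) < g j ∧ (∀ q, g' q = g q)) := by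
  obtain ⟨f1, f2, f3, le, ne, g3, g12⟩ := h
  by_cases hg : g' j = g (j+1) ∧ g' (j+1) = g j ∧ g j ≤ g (j+1)
  · left
    refine ⟨fun q => if q = j then j + 1 else if q = j + 1 then j else q, ?_, ?_, ?_, ?_⟩
    · intro q
      by_cases h1 : q = j
      · subst h1; simp [f2]
      by_cases h2 : q = j + 1
      · subst h2; simp [f1]
      simp [h1, h2, f3 q h1 h2]
    · intro q
      by_cases h1 : q = j
      · subst h1; simp [hg]
      by_cases h2 : q = j + 1
      · subst h2; simp [hg]
      simp [h1, h2, g3 q h1 h2]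
    · intro q q' hq
      by_cases hh : q = j ∧ q' = j + 1
      · right
        rw [hh.1, hh.2]; exact ⟨le, hg.2.2⟩
      · left
        dsimp only
        split_ifs <;> omega
    · intro q
      dsimp only
      split_ifs <;> omega
  · have hg' : g' j = g j ∧ g' (j+1) = g (j+1) ∧ g (j+1) ≤ g j := by omega
    have hgg : ∀ q, g' q = g q := by
      intro q
      by_cases h1 : q = j
      · subst h1; exact hg'.1
      by_cases h2 : q = j + 1
      · subst h2; exact hg'.2.1
      exact g3 q h1 h2
    rcases Nat.lt_or_ge (f j) (f (j+1)) with hf | hf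
    · right
      exact ⟨hf, by omega, hgg⟩
    · left
      refine ⟨fun q => q, ?_, hgg, fun q q' h => Or.inl h, fun q => rfl⟩
      intro q
      by_cases h1 : q = j
      · subst h1; dsimp only; omega
      by_cases h2 : q = j + 1
      · subst h2; dsimp only; omega
      exact f3 q h1 h2

theorem S2_step {α β : ℕ} {j : ℕ} {f g f' g' : ℕ → ℕ}
    (hb : Bd f) (hab' : (α = 2 ∧ β = 1) ∨ (α = 1 ∧ β = 0)) (h : RS j f g f' g') (hs : S2 α β β α f g) :
    S2 α β β α f' g' := by
  obtain ⟨p, p', h0, h1, h2, h3, h4, h5⟩ := hs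
  rcases step_cases h with ⟨m, m1, m2, m3, m4⟩ | ⟨b1, b2, b3⟩
  · refine ⟨m p, m p', ?_, by rw [m1, h1], by rw [m1, h2], by rw [m2, h3], by rw [m2, h4], ?_⟩
    · rcases m3 p p' h0 with h | h <;> omega
    · intro q q1 q2
      rw [← m4 q, m1, m2]
      apply h5
      · rintro h; exact q1 (by rw [← m4 q, h])
      · rintro h; exact q2 (by rw [← m4 q, h])
  · exfalso
    have x1 := hb.1 (j+1)
    have u1 := hb.2 p j; have u4 := hb.2 p' (j+1)
    have ej := h5 j; have ej' := h5 (j+1)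
    by_cases k1 : p = j
    · subst k1; omega
    by_cases k2 : p' = j + 1
    · subst k2; omega
    by_cases k3 : p = j + 1
    · subst k3; omega
    by_cases k4 : p' = j
    · subst k4; omega
    omega

theorem S3_bounce {α β γ α' β' γ' : ℕ} {j : ℕ} {f g f' g' : ℕ → ℕ}
    (hd : ¬ (α ≤ β ∧ α' ≤ β')) (hd' : ¬ (β ≤ γ ∧ β' ≤ γ'))
    (h : RS j f g f' g') (hs : S3 α β γ α' β' γ' f g) :
    S3 α β γ α' β' γ' f' g' ∨ (f j < f (j+1) ∧ g (j+1) < g j ∧ (∀ q, g' q = g q)) := by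
  obtain ⟨p, p', r, h0, h0', h1, h2, h2', h3, h4, h4', h5⟩ := hs
  rcases step_cases h with ⟨m, m1, m2, m3, m4⟩ | hb
  · left
    refine ⟨m p, m p', m r, ?_, ?_, by rw [m1, h1], by rw [m1, h2], by rw [m1, h2'], by rw [m2, h3], by rw [m2, h4],
      by rw [m2, h4'], ?_⟩
    · rcases m3 p p' h0 with h | h
      · exact h
      · rw [h1, h2, h3, h4] at h; exact absurd h hd
    · rcases m3 p' r h0' with h | h
      · exact h
      · rw [h2, h2', h4, h4'] at h; exact absurd h hd'
    · intro q q1 q2 q3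
      rw [← m4 q, m1, m2]
      apply h5
      · rintro h; exact q1 (by rw [← m4 q, h])
      · rintro h; exact q2 (by rw [← m4 q, h])
      · rintro h; exact q3 (by rw [← m4 q, h])
  · right; exact hb

/-- final states -/
theorem SB_step {α' β' γ' : ℕ} {j : ℕ} {f g f' g' : ℕ → ℕ}
    (hb : Bd f) (hab' : (α' = 0 ∧ β' = 2 ∧ γ' = 1) ∨ (α' = 1 ∧ β' = 0 ∧ γ' = 2)) (h : RS j f g f' g')
    (hs : S3 2 1 0 α' β' γ' f g) :
    S3 2 1 0 α' β' γ' f' g' := by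
  rcases S3_bounce (by omega) (by omega) h hs with h | ⟨b1, b2, b3⟩
  · exact h
  · exfalso
    obtain ⟨p, p', r, h0, h0', h1, h2, h2', h3, h4, h4', h5⟩ := hs
    have x1 := hb.1 (j+1)
    have u1 := hb.2 p' j; have u4 := hb.2 p' (j+1)
    have ej := h5 j; have ej' := h5 (j+1)
    by_cases k1 : p = j
    · subst k1; omega
    by_cases k2 : r = j + 1
    · subst k2; omega
    by_cases k3 : p = j + 1
    · subst k3; omega
    by_cases k4 : r = j
    · subst k4; omega
    by_cases k5 : p' = j
    · subst k5; omega
    by_cases k5 : p' = j + 1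
    · subst k5; omega
    omega

theorem SF_step {j : ℕ} {f g f' g' : ℕ → ℕ}
    (hb : Bd f) (h : RS j f g f' g')
    (hs : S3 2 0 1 0 2 1 f g) :
    S3 2 0 1 0 2 1 f' g' ∨ S3 2 1 0 0 2 1 f' g' := by
  rcases S3_bounce (by omega) (by omega) h hs with h | ⟨b1, b2, b3⟩
  · exact Or.inl h
  · right
    obtain ⟨p, p', r, h0, h0', h1, h2, h2', h3, h4, h4', h5⟩ := hs
    have x1 := hb.1 (j+1)
    have u1 := hb.2 r j; have u4 := hb.2 r (j+1)
    have ej := h5 j; have ej' := h5 (j+1)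
    have key : p' = j ∧ r = j + 1 := by
      by_cases k1 : p = j
      · subst k1; omega
      by_cases k3 : p = j + 1
      · subst k3; omega
      by_cases k5 : p' = j + 1
      · subst k5; omega
      by_cases k5 : p' = j
      · subst k5
        by_cases k6 : r = p' + 1
        · exact ⟨rfl, k6⟩
        · omega
      by_cases k6 : r = j
      · subst k6; omega
      by_cases k6 : r = j+1
      · subst k6; omega
      omega
    obtain ⟨rfl, rfl⟩ := key
    refine ⟨p, p', p' + 1, h0, h0', ?_, ?_, ?_, ?_, ?_, ?_, ?_⟩
    · rw [h.f3 p (by omega) (by omega), h1]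
    · rw [h.f1, h2']
    · rw [h.f2, h2]
    · rw [b3, h3]
    · rw [b3, h4]
    · rw [b3, h4']
    · intro q q1 q2 q3
      rw [b3, h.f3 q q2 q3, h5 q q1 q2 q3]

theorem SG_step {j : ℕ} {f g f' g' : ℕ → ℕ}
    (hb : Bd f) (h : RS j f g f' g')
    (hs : S3 1 2 0 1 0 2 f g) :
    S3 1 2 0 1 0 2 f' g' ∨ S3 2 1 0 1 0 2 f' g' := by
  rcases S3_bounce (by omega) (by omega) h hs with h | ⟨b1, b2, b3⟩
  · exact Or.inl h
  · right
    obtain ⟨p, p', r, h0, h0', h1, h2, h2', h3, h4, h4', h5⟩ := hs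
    have x1 := hb.1 (j+1)
    have u1 := hb.2 p j; have u4 := hb.2 p (j+1)
    have ej := h5 j; have ej' := h5 (j+1)
    have key : p = j ∧ p' = j + 1 := by
      by_cases k1 : r = j
      · subst k1; omega
      by_cases k3 : r = j + 1
      · subst k3; omega
      by_cases k5 : p' = j
      · subst k5; omega
      by_cases k5 : p' = j + 1
      · subst k5
        by_cases k6 : p = j
        · exact ⟨k6, rfl⟩
        · omega
      by_cases k6 : p = j
      · subst k6; omega
      by_cases k6 : p = j+1
      · subst k6; omega
      omega
    obtain ⟨rfl, rfl⟩ := key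
    refine ⟨p, p + 1, r, h0, h0', ?_, ?_, ?_, ?_, ?_, ?_, ?_⟩
    · rw [h.f1, h2]
    · rw [h.f2, h1]
    · rw [h.f3 r (by omega) (by omega), h2']
    · rw [b3, h3]
    · rw [b3, h4]
    · rw [b3, h4']
    · intro q q1 q2 q3
      rw [b3, h.f3 q q1 q2, h5 q q1 q2 q3]

end BSDist
namespace BSDist

def prj {n : ℕ} (b : ℕ) (y : Equiv.Perm (Fin n)) (q : ℕ) : ℕ :=
  if ev y q < b then 0 else if ev y q = b then 1 else 2

theorem prj_le {n : ℕ} (b : ℕ) (y : Equiv.Perm (Fin n)) (q : ℕ) : prj b y q ≤ 2 := by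
  unfold prj; split_ifs <;> omega

theorem prj_zero {n : ℕ} {b : ℕ} {y : Equiv.Perm (Fin n)} {q : ℕ} : prj b y q = 0 ↔ ev y q < b := by
  unfold prj; split_ifs <;> simp_all

theorem prj_one {n : ℕ} {b : ℕ} {y : Equiv.Perm (Fin n)} {q : ℕ} : prj b y q = 1 ↔ ev y q = b := by
  unfold prj; split_ifs <;> simp_all <;> omega

theorem prj_two {n : ℕ} {b : ℕ} {y : Equiv.Perm (Fin n)} {q : ℕ} : prj b y q = 2 ↔ b < ev y q := by
  unfold prj; split_ifs <;> simp_all <;> omega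

theorem prj_one' {n : ℕ} {b : ℕ} {y : Equiv.Perm (Fin n)} {q : ℕ} (h : prj b y q = 1) : ev y⁻¹ b = q := by
  rw [prj_one] at h
  rw [← h, ev_inv_ev]

theorem prj_mono {n : ℕ} {b : ℕ} {y z : Equiv.Perm (Fin n)} {p q : ℕ} (h : ev y p ≤ ev z q) :
    prj b y p ≤ prj b z q := by
  unfold prj; split_ifs <;> omega

theorem prj_congr {n : ℕ} {b : ℕ} {y z : Equiv.Perm (Fin n)} {p q : ℕ} (h : ev y p = ev z q) :
    prj b y p = prj b z q := by
  unfold prj; rw [h]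

theorem prj_Bd {n : ℕ} (b : ℕ) (y : Equiv.Perm (Fin n)) : Bd (prj b y) := by
  refine ⟨prj_le b y, fun p q hp hq => ?_⟩
  rw [← prj_one' hp, ← prj_one' hq]

theorem prj_RS {n j : ℕ} (b : ℕ) (h2 : j + 1 < n) (y z : Equiv.Perm (Fin n))
    (h : ev y j < ev y (j+1)) :
    RS j (prj b y) (prj b z) (prj b (y * sTr n (j+1))) (prj b (dm n z (j+1))) := by
  have h1 : 1 ≤ j + 1 := by omega
  have a1 := fun x => ev_mul_s1 h1 h2 x
  have a2 := fun x => ev_mul_s2 h1 h2 x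
  have a3 := fun x q => ev_mul_s3 h1 h2 x (q := q)
  have a4 := asc_iff h1 h2 z
  simp only [Nat.add_sub_cancel] at a1 a2 a3 a4
  refine ⟨prj_congr (a1 y), prj_congr (a2 y), fun q u v => prj_congr (a3 y q u v), prj_mono h.le, ?_, ?_, ?_⟩
  · rw [prj_one, prj_one]; omega
  · intro q u v
    unfold dm
    split_ifs with hd
    · exact prj_congr (a3 z q u v)
    · rfl
  · unfold dm
    split_ifs with hd
    · left
      exact ⟨prj_mono (a4.1 hd).le, prj_congr (a1 z), prj_congr (a2 z)⟩
    · right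
      refine ⟨prj_mono (by rw [a4] at hd; omega), rfl, rfl⟩

theorem inv_run {n : ℕ} (b : ℕ) (I : (ℕ → ℕ) → (ℕ → ℕ) → Prop)
    (hI : ∀ j f g f' g', Bd f → RS j f g f' g' → I f g → I f' g')
    (B : List ℕ) (y z : Equiv.Perm (Fin n)) (hA : Asc n y B) (h : I (prj b y) (prj b z)) :
    I (prj b (y * wprod n B)) (prj b (dmz n z B)) := by
  induction B generalizing y z with
  | nil => simpa [wprod_nil, dmz] using h
  | cons i B ih =>
    obtain ⟨⟨h1, h2, h3⟩, h4⟩ := hA.cons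
    rw [wprod_cons, ← mul_assoc]
    have : dmz n z (i :: B) = dmz n (dm n z i) B := rfl
    rw [this]
    apply ih _ _ h4
    obtain ⟨j, rfl⟩ : ∃ j, i = j + 1 := ⟨i - 1, by omega⟩
    exact hI j _ _ _ _ (prj_Bd b y) (prj_RS b h2 y z (by simpa using h3)) h

def Anti {n : ℕ} (w : Equiv.Perm (Fin n)) : Prop := ∀ p q, p < q → q < n → ev w q < ev w p

theorem lt_of_ev {n : ℕ} {w : Equiv.Perm (Fin n)} {q : ℕ} (h : ev w q < n) : q < n := by
  by_contra hc
  rw [ev_ge w (by omega)] at h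
  omega

structure KeyC {n : ℕ} (a c : ℕ) (y x ω : Equiv.Perm (Fin n)) : Prop where
  out : ∀ b, b < a ∨ c < b → ev x⁻¹ b = ev ω⁻¹ b
  ea : ev x⁻¹ a < ev ω⁻¹ a
  ec : ev ω⁻¹ c < ev x⁻¹ c
  fw : ∀ b, a < b → b < c → ev y⁻¹ a < ev y⁻¹ b → ev ω⁻¹ b < ev x⁻¹ b
  bw : ∀ b, a < b → b < c → ¬ ev y⁻¹ a < ev y⁻¹ b → ev x⁻¹ b < ev ω⁻¹ b

theorem key {n i : ℕ} (A B : List ℕ) (h : Asc n 1 (A ++ i :: B))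
    (hω : Anti (wprod n (A ++ i :: B))) :
    KeyC (ev (wprod n A) (i-1)) (ev (wprod n A) i) (wprod n A) (dmz n (wprod n A) B)
      (wprod n (A ++ i :: B)) := by
  obtain ⟨h1, h2, h3⟩ := h A i B rfl
  have h4 := (h.split.2).cons.2
  rw [one_mul] at h3 h4
  rw [wprod_append, wprod_cons, ← mul_assoc] at hω ⊢
  set y := wprod n A with hy
  set ω := y * sTr n i * wprod n B with hω'
  set x := dmz n y B with hx
  have a1 := ev_mul_s1 h1 h2 y
  have a2 := ev_mul_s2 h1 h2 y
  have a3 := fun q => ev_mul_s3 h1 h2 y (q := q)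
  have c_lt : ev y i < n := ev_lt y h2
  have i1 := ev_inv_ev y (i-1)
  have i2 := ev_inv_ev y i
  set a := ev y (i-1) with ha
  set c := ev y i with hc
  have run := fun b I hI h0 => inv_run b I hI B (y * sTr n i) y h4 h0
  constructor
  · intro b hb
    have := run b (fun f g => ∀ q, f q = g q) (fun j f g f' g' _ r hs => same_step r hs) ?_
    · have h5 : prj b ω (ev ω⁻¹ b) = 1 := by rw [prj_one, ev_ev_inv]
      rw [this] at h5
      exact prj_one' h5
    · intro q
      by_cases q1 : q = i - 1
      · subst q1; unfold prj; rw [a1, ← ha]; split_ifs <;> omega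
      by_cases q2 : q = i
      · subst q2; unfold prj; rw [a2, ← hc]; split_ifs <;> omega
      exact prj_congr (a3 q q1 q2)
  · have := run a (S2 2 1 1 2) (fun j f g f' g' hb r hs => S2_step hb (by omega) r hs) ?_
    · obtain ⟨p, p', e0, e1, e2, e3, e4, e5⟩ := this
      rw [prj_one' e3, prj_one' e2]; exact e0
    · refine ⟨i-1, i, by omega, ?_, ?_, ?_, ?_, fun q q1 q2 => prj_congr (a3 q q1 q2)⟩
      · rw [prj_two, a1]; exact h3
      · rw [prj_one, a2]
      · rw [prj_one]
      · rw [prj_two]; exact h3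
  · have := run c (S2 1 0 0 1) (fun j f g f' g' hb r hs => S2_step hb (by omega) r hs) ?_
    · obtain ⟨p, p', e0, e1, e2, e3, e4, e5⟩ := this
      rw [prj_one' e1, prj_one' e4]; exact e0
    · refine ⟨i-1, i, by omega, ?_, ?_, ?_, ?_, fun q q1 q2 => prj_congr (a3 q q1 q2)⟩
      · rw [prj_one, a1]
      · rw [prj_zero, a2]; exact h3
      · rw [prj_zero]; exact h3
      · rw [prj_one]
  · intro b b1 b2 b3
    have := run b (fun f g => S3 2 0 1 0 2 1 f g ∨ S3 2 1 0 0 2 1 f g) (fun j f g f' g' hb r hs => by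
      rcases hs with hs | hs
      · exact SF_step hb r hs
      · exact Or.inr (SB_step hb (by omega) r hs)) ?_
    · rcases this with ⟨p, p', r, e0, e0', e1, e2, e3, e4, e5, e6, e7⟩ | ⟨p, p', r, e0, e0', e1, e2, e3, e4, e5, e6, e7⟩
      · exfalso
        rw [prj_zero, ← hω'] at e2
        rw [prj_one, ← hω'] at e3
        have : r < n := lt_of_ev (w := ω) (by omega)
        have := hω p' r e0' this
        omega
      · rw [prj_one' e2, prj_one' e6]; exact e0'
    · left
      have hne : ev y⁻¹ b ≠ i := by
        intro h
        have := ev_ev_inv y b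
        rw [h] at this; omega
      have e1 : prj b y (ev y⁻¹ b) = 1 := by rw [prj_one, ev_ev_inv]
      have hs : ∀ q, q ≠ i - 1 → q ≠ i → prj b (y * sTr n i) q = prj b y q := fun q q1 q2 => prj_congr (a3 q q1 q2)
      refine ⟨i-1, i, ev y⁻¹ b, by omega, by omega, ?_, ?_, ?_, ?_, ?_, e1, fun q q1 q2 _ => hs q q1 q2⟩
      · rw [prj_two, a1]; omega
      · rw [prj_zero, a2]; omega
      · rw [hs _ (by omega) (by omega), e1]
      · rw [prj_zero]; omega
      · rw [prj_two]; omega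
  · intro b b1 b2 b3
    have := run b (fun f g => S3 1 2 0 1 0 2 f g ∨ S3 2 1 0 1 0 2 f g) (fun j f g f' g' hb r hs => by
      rcases hs with hs | hs
      · exact SG_step hb r hs
      · exact Or.inr (SB_step hb (by omega) r hs)) ?_
    · rcases this with ⟨p, p', r, e0, e0', e1, e2, e3, e4, e5, e6, e7⟩ | ⟨p, p', r, e0, e0', e1, e2, e3, e4, e5, e6, e7⟩
      · exfalso
        rw [prj_one, ← hω'] at e1
        rw [prj_two, ← hω'] at e2
        rw [prj_zero, ← hω'] at e3
        have : r < n := lt_of_ev (w := ω) (by omega)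
        have := hω p p' e0 (by omega)
        omega
      · rw [prj_one' e2, prj_one' e4]; exact e0
    · left
      have hne : ev y⁻¹ b ≠ i - 1 := by
        intro h
        have := ev_ev_inv y b
        rw [h] at this; omega
      have e1 : prj b y (ev y⁻¹ b) = 1 := by rw [prj_one, ev_ev_inv]
      have hs : ∀ q, q ≠ i - 1 → q ≠ i → prj b (y * sTr n i) q = prj b y q := fun q q1 q2 => prj_congr (a3 q q1 q2)
      refine ⟨ev y⁻¹ b, i-1, i, by omega, by omega, ?_, ?_, ?_, e1, ?_, ?_, fun q _ q1 q2 => hs q q1 q2⟩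
      · rw [hs _ (by omega) (by omega), e1]
      · rw [prj_two, a1]; omega
      · rw [prj_zero, a2]; omega
      · rw [prj_zero]; omega
      · rw [prj_two]; omega

theorem key_unique {n : ℕ} {a c a' c' : ℕ} {y y' x ω : Equiv.Perm (Fin n)}
    (h : KeyC a c y x ω) (h' : KeyC a' c' y' x ω) :
    a = a' ∧ c = c' ∧ ∀ b, a < b → b < c → (ev y⁻¹ a < ev y⁻¹ b ↔ ev y'⁻¹ a < ev y'⁻¹ b) := by
  have e1 : a = a' := by
    by_contra hne
    rcases Nat.lt_or_gt_of_ne hne with hl | hl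
    · have := h'.out a (Or.inl hl); have := h.ea; omega
    · have := h.out a' (Or.inl hl); have := h'.ea; omega
  have e2 : c = c' := by
    by_contra hne
    rcases Nat.lt_or_gt_of_ne hne with hl | hl
    · have := h.out c' (Or.inr hl); have := h'.ec; omega
    · have := h'.out c (Or.inr hl); have := h.ec; omega
  subst e1 e2
  refine ⟨rfl, rfl, fun b b1 b2 => ?_⟩
  have := h.fw b b1 b2; have := h.bw b b1 b2
  have := h'.fw b b1 b2; have := h'.bw b b1 b2
  constructor
  · intro q; by_contra q'; omega
  · intro q; by_contra q'; omega

end BSDist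
namespace BSDist

noncomputable def stp (n : ℕ) (f : Equiv.Perm (Fin n) → Polynomial ℤ) (i : ℕ) :
    Equiv.Perm (Fin n) → Polynomial ℤ := fun x =>
  if len x < len (x * sTr n i) then f x + f (x * sTr n i)
      else Polynomial.X * f x + Polynomial.X * f (x * sTr n i)

theorem wt_eq (n : ℕ) (R : List ℕ) : wt n R = R.foldl (stp n) (fun x => if x = 1 then 1 else 0) := rfl

theorem wt_app (n : ℕ) (A B : List ℕ) : wt n (A ++ B) = B.foldl (stp n) (wt n A) := by
  rw [wt_eq, wt_eq, List.foldl_append]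

theorem wt_snoc (n : ℕ) (R : List ℕ) (i : ℕ) (x : Equiv.Perm (Fin n)) :
    wt n (R ++ [i]) x = if len x < len (x * sTr n i) then wt n R x + wt n R (x * sTr n i)
      else Polynomial.X * wt n R x + Polynomial.X * wt n R (x * sTr n i) := by
  rw [wt_app]; rfl

theorem sTr_comm {n i j : ℕ} (hi : 1 ≤ i ∧ i < n) (hj : 1 ≤ j ∧ j < n) (h : i + 1 < j ∨ j + 1 < i) :
    sTr n i * sTr n j = sTr n j * sTr n i := by
  apply ev_ext
  intro q
  rw [ev_mul, ev_mul]
  simp only [ev_s hi.1 hi.2, ev_s hj.1 hj.2]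
  split_ifs <;> omega

theorem stp_comm {n i j : ℕ} (hi : 1 ≤ i ∧ i < n) (hj : 1 ≤ j ∧ j < n) (h : i + 1 < j ∨ j + 1 < i)
    (f : Equiv.Perm (Fin n) → Polynomial ℤ) : stp n (stp n f i) j = stp n (stp n f j) i := by
  funext x
  have e1 : x * sTr n j * sTr n i = x * sTr n i * sTr n j := by
    rw [mul_assoc, mul_assoc, sTr_comm hi hj h]
  have a1 := asc_iff hi.1 hi.2 x
  have a2 := asc_iff hj.1 hj.2 x
  have a3 := asc_iff hi.1 hi.2 (x * sTr n j)
  have a4 := asc_iff hj.1 hj.2 (x * sTr n i)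
  rw [ev_mul_s3 hj.1 hj.2 x (by omega) (by omega), ev_mul_s3 hj.1 hj.2 x (by omega) (by omega), ← a1] at a3
  rw [ev_mul_s3 hi.1 hi.2 x (by omega) (by omega), ev_mul_s3 hi.1 hi.2 x (by omega) (by omega), ← a2] at a4
  rw [e1] at a3
  unfold stp
  simp only [a3, a4, e1]
  split_ifs <;> ring

theorem CommMove.props {n : ℕ} {R R' : List ℕ} (hA : Alphabet n R) (h : CommMove R R') :
    Alphabet n R' ∧ wprod n R = wprod n R' ∧ R.length = R'.length ∧ wt n R = wt n R' := by
  obtain ⟨A, B, i, j, hij, rfl, rfl⟩ := h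
  have hi := hA i (by simp)
  have hj := hA j (by simp)
  refine ⟨?_, ?_, by simp, ?_⟩
  · intro k hk
    apply hA k
    simp at hk ⊢
    tauto
  · simp only [wprod_append, wprod_cons, wprod_nil, mul_one]
    rw [sTr_comm hi hj hij]
  · rw [wt_app, wt_app, wt_app, wt_app]
    simp only [List.foldl_cons, List.foldl_nil]
    rw [stp_comm hi hj hij]

theorem CommEquiv.props {n : ℕ} {R R' : List ℕ} (hA : Alphabet n R) (h : CommEquiv R R') :
    Alphabet n R' ∧ wprod n R = wprod n R' ∧ R.length = R'.length ∧ wt n R = wt n R' := by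
  induction h with
  | refl => exact ⟨hA, rfl, rfl, rfl⟩
  | tail _ h ih =>
    obtain ⟨a, b, c, d⟩ := ih
    obtain ⟨a', b', c', d'⟩ := h.props a
    exact ⟨a', b.trans b', c.trans c', d.trans d'⟩

theorem CommMove.append {R R' : List ℕ} (h : CommMove R R') (P Q : List ℕ) :
    CommMove (P ++ R ++ Q) (P ++ R' ++ Q) := by
  obtain ⟨A, B, i, j, hij, rfl, rfl⟩ := h
  exact ⟨P ++ A, B ++ Q, i, j, hij, by simp, by simp⟩

theorem CommEquiv.append {R R' : List ℕ} (h : CommEquiv R R') (P Q : List ℕ) :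
    CommEquiv (P ++ R ++ Q) (P ++ R' ++ Q) := by
  induction h with
  | refl => exact Relation.ReflTransGen.refl
  | tail _ h ih => exact ih.tail (h.append P Q)

theorem CommMove.symm {R R' : List ℕ} (h : CommMove R R') : CommMove R' R := by
  obtain ⟨A, B, i, j, hij, rfl, rfl⟩ := h
  exact ⟨A, B, j, i, hij.symm, rfl, rfl⟩

theorem commEquiv_move (i : ℕ) (D : List ℕ) (h : ∀ d ∈ D, i + 1 < d ∨ d + 1 < i) :
    CommEquiv (i :: D) (D ++ [i]) := by
  induction D with
  | nil => exact Relation.ReflTransGen.refl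
  | cons d D ih =>
    have h1 : CommMove (i :: d :: D) (d :: i :: D) := ⟨[], D, i, d, h d (by simp), by simp, by simp⟩
    have h2 := (ih (fun e he => h e (by simp [he]))).append [d] []
    simp at h2
    exact Relation.ReflTransGen.head h1 h2

/-- The set of one-letter-deleted Demazure products -/
def XS (n : ℕ) (R : List ℕ) (x : Equiv.Perm (Fin n)) : Prop :=
  ∃ A i B, R = A ++ i :: B ∧ x = dmz n (wprod n A) B

theorem dmz_snoc (n : ℕ) (z : Equiv.Perm (Fin n)) (B : List ℕ) (i : ℕ) :
    dmz n z (B ++ [i]) = dm n (dmz n z B) i := by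
  simp [dmz]

theorem XS_snoc (n : ℕ) (R : List ℕ) (i : ℕ) (x : Equiv.Perm (Fin n)) :
    XS n (R ++ [i]) x ↔ x = wprod n R ∨ ∃ x', XS n R x' ∧ x = dm n x' i := by
  constructor
  · rintro ⟨A, k, B, h1, h2⟩
    rcases List.eq_nil_or_concat B with rfl | ⟨B', b, rfl⟩
    · left
      have := List.append_inj' h1 rfl
      rw [this.1]; exact h2
    · right
      rw [List.concat_eq_append] at h1 h2
      have h3 : R ++ [i] = (A ++ k :: B') ++ [b] := by simpa using h1
      have := List.append_inj' h3 rfl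
      refine ⟨_, ⟨A, k, B', this.1, rfl⟩, ?_⟩
      rw [h2, dmz_snoc]
      have : i = b := by simpa using this.2
      rw [this]
  · rintro (h | ⟨x', ⟨A, k, B, rfl, rfl⟩, h⟩)
    · exact ⟨R, i, [], rfl, h⟩
    · exact ⟨A, k, B ++ [i], by simp, by rw [h, dmz_snoc]⟩

theorem wt_main {n : ℕ} (R : List ℕ) (h : Asc n 1 R) :
    (∀ x, (wt n R x).natDegree ≤ R.length) ∧
    (∀ x, (wt n R x).coeff R.length = if x = wprod n R then 1 else 0) ∧
    (∀ m x, m + 1 = R.length → 0 ≤ (wt n R x).coeff m ∧ (0 < (wt n R x).coeff m ↔ XS n R x)) := by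
  induction R using List.reverseRecOn with
  | nil =>
    refine ⟨?_, ?_, ?_⟩
    · intro x; rw [wt_eq]; simp only [List.foldl_nil]; split_ifs <;> simp
    · intro x; rw [wt_eq]; simp only [List.foldl_nil, wprod_nil]; split_ifs <;> simp
    · intro m x h; simp at h
  | append_singleton R i ih =>
    obtain ⟨ih1, ih2, ih3⟩ := ih h.split.1
    obtain ⟨h1, h2, h3⟩ := h R i [] rfl
    rw [one_mul] at h3
    have hasc := (asc_iff h1 h2 (wprod n R)).2 h3
    have hz : ∀ x, (wt n R x).coeff (R.length + 1) = 0 := fun x =>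
      Polynomial.coeff_eq_zero_of_natDegree_lt (by have := ih1 x; omega)
    have hw : wprod n (R ++ [i]) = wprod n R * sTr n i := by
      rw [wprod_append, wprod_cons, wprod_nil, mul_one]
    have hiff : ∀ x, x * sTr n i = wprod n R ↔ x = wprod n R * sTr n i := by
      intro x
      constructor
      · intro h; rw [← h, mul_s_s]
      · intro h; rw [h, mul_s_s]
    refine ⟨?_, ?_, ?_⟩
    · intro x
      rw [wt_snoc, List.length_append, List.length_singleton]
      split_ifs
      · refine (Polynomial.natDegree_add_le _ _).trans (max_le ?_ ?_)
        · exact (ih1 _).trans (by omega)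
        · exact (ih1 _).trans (by omega)
      · refine (Polynomial.natDegree_add_le _ _).trans (max_le ?_ ?_)
        · refine (Polynomial.natDegree_mul_le).trans ?_
          rw [Polynomial.natDegree_X]; have := ih1 x; omega
        · refine (Polynomial.natDegree_mul_le).trans ?_
          rw [Polynomial.natDegree_X]; have := ih1 (x * sTr n i); omega
    · intro x
      rw [wt_snoc, List.length_append, List.length_singleton, hw]
      split_ifs with c1 c2 c2
      · exfalso
        rw [c2, mul_s_s] at c1; omega
      · simp [hz]
      · simp only [Polynomial.coeff_add, Polynomial.coeff_X_mul, ih2, hiff, c2, if_true]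
        rw [if_neg]
        · simp
        · intro h
          have := congrArg len h
          omega
      · simp only [Polynomial.coeff_add, Polynomial.coeff_X_mul, ih2, hiff, c2, if_false]
        rw [if_neg]
        · simp
        · intro h
          rw [h] at c1; exact c1 hasc
    · intro m x hm
      rw [List.length_append, List.length_singleton] at hm
      obtain rfl : m = R.length := by omega
      rw [XS_snoc, wt_snoc]
      split_ifs with c1
      · have n1 : x ≠ wprod n R * sTr n i := by
          intro h
          rw [h, mul_s_s] at c1; omega
        have n2 : ¬ ∃ x', XS n R x' ∧ x = dm n x' i := by
          rintro ⟨x', _, h⟩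
          unfold dm at h
          split_ifs at h with c2
          · rw [h, mul_s_s] at c1; omega
          · rw [h] at c1; exact c2 c1
        simp only [Polynomial.coeff_add, ih2, hiff, n1, n2, or_false, if_false]
        split_ifs with c3 <;> simp [c3]
      · have n1 : x ≠ wprod n R := by
          intro h
          rw [h] at c1; exact c1 hasc
        have n2 : (∃ x', XS n R x' ∧ x = dm n x' i) ↔ XS n R x ∨ XS n R (x * sTr n i) := by
          constructor
          · rintro ⟨x', h', h⟩
            unfold dm at h
            split_ifs at h with c2
            · right; rw [h, mul_s_s]; exact h'
            · left; rw [h]; exact h'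
          · have c2 : len (x * sTr n i) < len x := by
              have a := asc_iff h1 h2 x
              have b := asc_iff h1 h2 (x * sTr n i)
              rw [mul_s_s, ev_mul_s1 h1 h2, ev_mul_s2 h1 h2] at b
              rw [b]
              rw [a] at c1
              have hne : ev x (i-1) ≠ ev x i := fun h => by have := ev_inj x h; omega
              omega
            rintro (h | h)
            · refine ⟨x, h, ?_⟩
              unfold dm; rw [if_neg c1]
            · refine ⟨_, h, ?_⟩
              unfold dm; rw [mul_s_s, if_pos c2]
        simp only [n1, n2, false_or]
        rcases Nat.eq_zero_or_pos R.length with h0 | h0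
        · have hR := List.eq_nil_of_length_eq_zero h0
          subst hR
          have : ∀ x, ¬ XS n [] x := by
            rintro x ⟨A, k, B, h, _⟩
            simp at h
          simp [this]
        · obtain ⟨m, hm⟩ : ∃ m, m + 1 = R.length := ⟨R.length - 1, by omega⟩
          rw [← hm]
          simp only [Polynomial.coeff_add, Polynomial.coeff_X_mul]
          obtain ⟨p1, p2⟩ := ih3 m x hm
          obtain ⟨p3, p4⟩ := ih3 m (x * sTr n i) hm
          rw [← p2, ← p4]
          constructor
          · omega
          · omega

theorem XS_iff {n : ℕ} {R R' : List ℕ} (h : Asc n 1 R) (h' : Asc n 1 R') (hl : R.length = R'.length)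
    (hw : wt n R = wt n R') (x : Equiv.Perm (Fin n)) : XS n R x → XS n R' x := by
  intro hx
  have hpos : 0 < R.length := by
    obtain ⟨A, i, B, rfl, _⟩ := hx
    simp
  obtain ⟨m, hm⟩ : ∃ m, m + 1 = R.length := ⟨R.length - 1, by omega⟩
  have := ((wt_main R h).2.2 m x hm).2.2 hx
  rw [hw] at this
  exact ((wt_main R' h').2.2 m x (by omega)).2.1 this

theorem key2 {n : ℕ} {R R' : List ℕ} (h : Asc n 1 R) (h' : Asc n 1 R') (hl : R.length = R'.length)
    (hp : wprod n R = wprod n R') (ha : Anti (wprod n R))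
    (hw : wt n R = wt n R') (A B : List ℕ) (i : ℕ) (hR : R = A ++ i :: B) :
    ∃ A' i' B', R' = A' ++ i' :: B' ∧ ev (wprod n A) (i-1) = ev (wprod n A') (i'-1) ∧
      ev (wprod n A) i = ev (wprod n A') i' ∧
      ∀ b, ev (wprod n A) (i-1) < b → b < ev (wprod n A) i →
        (ev (wprod n A)⁻¹ (ev (wprod n A) (i-1)) < ev (wprod n A)⁻¹ b ↔
        ev (wprod n A')⁻¹ (ev (wprod n A) (i-1)) < ev (wprod n A')⁻¹ b) := by
  obtain ⟨A', i', B', h1, h2⟩ := XS_iff h h' hl hw (dmz n (wprod n A) B) ⟨A, i, B, hR, rfl⟩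
  refine ⟨A', i', B', h1, ?_⟩
  subst hR h1
  have k1 := key A B h ha
  have k2 := key A' B' h' (hp ▸ ha)
  rw [← h2, ← hp] at k2
  exact key_unique k1 k2

theorem wt_start {n : ℕ} {R R' : List ℕ} (h : IsReducedWord n R) (h' : IsReducedWord n R')
    (H : ∀ x : Equiv.Perm (Fin n),
        wt n R x * (1 + Polynomial.X) ^ R'.length
          = wt n R' x * (1 + Polynomial.X) ^ R.length) :
    wprod n R = wprod n R' ∧ R.length = R'.length ∧ wt n R = wt n R' := by
  obtain ⟨a1, a2, _⟩ := wt_main R (reduced_asc h)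
  obtain ⟨b1, b2, _⟩ := wt_main R' (reduced_asc h')
  have d : ∀ k : ℕ, ((1 + Polynomial.X : Polynomial ℤ) ^ k).natDegree ≤ k := by
    intro k
    refine Polynomial.natDegree_pow_le.trans ?_
    have : (1 + Polynomial.X : Polynomial ℤ).natDegree ≤ 1 := by
      have := Polynomial.natDegree_X_add_C (1:ℤ)
      rw [map_one] at this
      rw [add_comm]; exact this.le
    nlinarith
  have l : ∀ k : ℕ, ((1 + Polynomial.X : Polynomial ℤ) ^ k).coeff k = 1 := by
    intro k
    rw [Polynomial.coeff_one_add_X_pow]; simp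
  have e : wprod n R = wprod n R' := by
    have h1 := congrArg (fun p => Polynomial.coeff p (R.length + R'.length)) (H (wprod n R))
    beta_reduce at h1
    rw [Polynomial.coeff_mul_add_eq_of_natDegree_le (a1 _) (d _), a2, l] at h1
    rw [Nat.add_comm R.length, Polynomial.coeff_mul_add_eq_of_natDegree_le (b1 _) (d _), b2, l] at h1
    by_contra hc
    simp [hc] at h1
  have e2 : R.length = R'.length := by rw [h.2, h'.2, e]
  refine ⟨e, e2, ?_⟩
  funext x
  have := H x
  rw [e2] at this
  refine mul_right_cancel₀ (pow_ne_zero _ ?_) this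
  intro h0
  have := l 1
  rw [h0] at this; simp at this

end BSDist
namespace BSDist

theorem split_prefix {n : ℕ} {P Q C D' : List ℕ} {i : ℕ} (h : Asc n 1 (P ++ Q))
    (hs : P ++ Q = C ++ i :: D')
    (hi : ev (wprod n P)⁻¹ (ev (wprod n C) i) < ev (wprod n P)⁻¹ (ev (wprod n C) (i-1))) :
    ∃ D, P = C ++ i :: D ∧ D' = D ++ Q := by
  obtain ⟨h1, h2, h3⟩ := h C i D' hs
  rw [one_mul] at h3
  have key : ∀ a', C = P ++ a' → Q = a' ++ i :: D' → False := by
    intro a' e1 e2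
    have hA := h.split.2
    rw [e2] at hA
    have hA' := hA.split.1
    rw [one_mul] at hA'
    have := inv_mono a' (wprod n P) hA' h3 hi
    rw [← wprod_append, ← e1, ev_inv_ev, ev_inv_ev] at this
    omega
  rcases List.append_eq_append_iff.1 hs with ⟨a', e1, e2⟩ | ⟨c', e1, e2⟩
  · exact (key a' e1 e2).elim
  · cases c' with
    | nil => exact (key [] (by simpa using e1.symm) (by simpa using e2.symm)).elim
    | cons k D =>
      simp only [List.cons_append, List.cons.injEq] at e2
      obtain ⟨rfl, e2⟩ := e2
      exact ⟨D, e1, e2⟩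

theorem ev_inv_eq {n : ℕ} {w : Equiv.Perm (Fin n)} {p q : ℕ} (h : ev w p = q) : ev w⁻¹ q = p := by
  rw [← h, ev_inv_ev]

theorem main_ind {n : ℕ} (R₂ : List ℕ) : ∀ (R₁ Q : List ℕ), R₁.length = R₂.length →
    Asc n 1 (R₁ ++ Q) → Asc n 1 (R₂ ++ Q) → wprod n (R₁ ++ Q) = wprod n (R₂ ++ Q) →
    Anti (wprod n (R₁ ++ Q)) → wt n (R₁ ++ Q) = wt n (R₂ ++ Q) → CommEquiv R₁ R₂ := by
  induction R₂ using List.reverseRecOn with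
  | nil =>
    intro R₁ Q hl _ _ _ _ _
    have := List.eq_nil_of_length_eq_zero hl
    subst this
    exact Relation.ReflTransGen.refl
  | append_singleton A j ih =>
    intro R₁ Q hl hA1 hA2 hp ha hw
    have hlen : (R₁ ++ Q).length = (A ++ [j] ++ Q).length := by
      rw [List.length_append, List.length_append, hl]
    have hpp : wprod n R₁ = wprod n (A ++ [j]) := by
      rw [wprod_append, wprod_append] at hp
      exact mul_right_cancel hp
    obtain ⟨j1, j2, j3⟩ := hA2 A j Q (by simp)
    rw [one_mul] at j3
    obtain ⟨C, i, D', hC, c1, c2, _⟩ := key2 hA2 hA1 hlen.symm hp.symm (hp ▸ ha) hw.symm A Q j (by simp)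
    have hw2 : wprod n (A ++ [j]) = wprod n A * sTr n j := by
      rw [wprod_append, wprod_cons, wprod_nil, mul_one]
    obtain ⟨u, hu⟩ : ∃ u, ev (wprod n A) (j-1) = u := ⟨_, rfl⟩
    obtain ⟨v, hv⟩ : ∃ v, ev (wprod n A) j = v := ⟨_, rfl⟩
    rw [hu] at c1 j3
    rw [hv] at c2 j3
    -- positions in the final permutation
    have fv : ev (wprod n R₁)⁻¹ v = j - 1 := by
      apply ev_inv_eq; rw [hpp, hw2, ev_mul_s1 j1 j2, hv]
    have fu : ev (wprod n R₁)⁻¹ u = j := by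
      apply ev_inv_eq; rw [hpp, hw2, ev_mul_s2 j1 j2, hu]
    obtain ⟨D, hD, hD'⟩ := split_prefix hA1 hC (by rw [← c1, ← c2, fv, fu]; omega)
    have hAR1 : Asc n 1 R₁ := hA1.split.1
    obtain ⟨i1, i2, i3⟩ := hAR1 C i D hD
    -- key facts on crossings of `R₂`
    have notinv : ∀ A2 k B2, A ++ [j] ++ Q = A2 ++ k :: B2 →
        ev (wprod n R₁)⁻¹ (ev (wprod n A2) k) < ev (wprod n R₁)⁻¹ (ev (wprod n A2) (k-1)) →
        ¬ ev (wprod n A2)⁻¹ v < ev (wprod n A2)⁻¹ u := by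
      intro A2 k B2 h1 h2 h3
      rw [hpp] at h2
      obtain ⟨D3, h4, _⟩ := split_prefix hA2 h1 h2
      have h5 : ∃ D4, A = A2 ++ D4 := by
        rcases List.eq_nil_or_concat D3 with rfl | ⟨D4, b, rfl⟩
        · exact ⟨[], by simpa using (List.append_inj' h4 rfl).1⟩
        · rw [List.concat_eq_append] at h4
          have h6 : A ++ [j] = (A2 ++ k :: D4) ++ [b] := by simpa using h4
          exact ⟨k :: D4, (List.append_inj' h6 rfl).1⟩
      obtain ⟨D4, h5⟩ := h5
      have h6 : Asc n 1 A := hA2.split.1.split.1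
      rw [h5] at h6
      have h7 := h6.split.2
      rw [one_mul] at h7
      have := inv_mono D4 _ h7 j3 h3
      rw [← wprod_append, ← h5, ev_inv_eq hu, ev_inv_eq hv] at this
      omega
    have claim : ∀ D1 D2, D = D1 ++ D2 → (∀ d ∈ D1, i + 1 < d ∨ d + 1 < i) ∧
        ev (wprod n (C ++ i :: D1)) (i-1) = v ∧ ev (wprod n (C ++ i :: D1)) i = u := by
      intro D1
      induction D1 using List.reverseRecOn with
      | nil =>
        intro D2 _
        have : wprod n (C ++ [i]) = wprod n C * sTr n i := by
          rw [wprod_append, wprod_cons, wprod_nil, mul_one]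
        refine ⟨by simp, ?_, ?_⟩
        · rw [this, ev_mul_s1 i1 i2, c2]
        · rw [this, ev_mul_s2 i1 i2, c1]
      | append_singleton D1 d ih' =>
        intro D2 hD2
        obtain ⟨m1, m2, m3⟩ := ih' (d :: D2) (by simpa using hD2)
        obtain ⟨E, hE⟩ : ∃ E, E = C ++ i :: D1 := ⟨_, rfl⟩
        rw [← hE] at m2 m3
        have hRE : R₁ = E ++ d :: D2 := by rw [hD, hD2, hE]; simp
        obtain ⟨d1, d2, d3⟩ := hAR1 E d D2 hRE
        rw [one_mul] at d3
        have hEd : wprod n (C ++ i :: (D1 ++ [d])) = wprod n E * sTr n d := by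
          have : C ++ i :: (D1 ++ [d]) = E ++ [d] := by rw [hE]; simp
          rw [this, wprod_append, wprod_cons, wprod_nil, mul_one]
        have hrest : Asc n (wprod n E * sTr n d) D2 := by
          have := hAR1
          rw [hRE] at this
          have := this.split.2.cons.2
          rwa [one_mul] at this
        have hmono : ∀ a c, a < c → ev (wprod n E * sTr n d)⁻¹ c < ev (wprod n E * sTr n d)⁻¹ a →
            ev (wprod n R₁)⁻¹ c < ev (wprod n R₁)⁻¹ a := by
          intro a c hac h
          have := inv_mono D2 _ hrest hac h
          rwa [mul_assoc, ← wprod_cons, ← wprod_append, ← hRE] at this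
        obtain ⟨A2, k, B2, t1, t2, t3, t4⟩ := key2 hA1 hA2 hlen hp ha hw E (D2 ++ Q) d (by rw [hRE]; simp)
        have pv := ev_inv_eq m2
        have pu := ev_inv_eq m3
        have s1 := ev_mul_s1 d1 d2 (wprod n E)
        have s2 := ev_mul_s2 d1 d2 (wprod n E)
        have s3 := fun q => ev_mul_s3 d1 d2 (wprod n E) (q := q)
        have hni := notinv A2 k B2 t1 (by
          rw [← t2, ← t3]
          apply hmono _ _ d3
          rw [ev_inv_eq s1, ev_inv_eq s2]; omega)
        have hdi : d ≠ i := by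
          rintro rfl
          omega
        have hd1 : d ≠ i + 1 := by
          rintro rfl
          simp only [Nat.add_sub_cancel] at *
          rw [m3] at t2 t4 d3 s2
          obtain ⟨b, hb⟩ : ∃ b, ev (wprod n E) (i+1) = b := ⟨_, rfl⟩
          rw [hb] at t3 t4 d3 s1
          have hbv : b ≠ v := by
            intro h
            rw [← hb, ← m2] at h
            have := ev_inj _ h
            omega
          rcases Nat.lt_or_gt_of_ne hbv with hlt | hlt
          · have g1 := hmono b v hlt (by
              rw [ev_inv_eq s1, ev_inv_eq ((s3 (i-1) (by omega) (by omega)).trans m2)]; omega)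
            have g2 := hmono u b d3 (by rw [ev_inv_eq s1, ev_inv_eq s2]; omega)
            omega
          · have := t4 v j3 hlt
            rw [pv, pu] at this
            have hne : ev (wprod n A2)⁻¹ v ≠ ev (wprod n A2)⁻¹ u := by
              intro h
              have := ev_inj _ h
              omega
            omega
        have hd2 : d + 1 ≠ i := by
          rintro rfl
          simp only [Nat.add_sub_cancel] at *
          rw [m2] at t3 t4 d3 s1
          obtain ⟨b, hb⟩ : ∃ b, ev (wprod n E) (d-1) = b := ⟨_, rfl⟩
          rw [hb] at t2 t4 d3 s2
          have hbu : b ≠ u := by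
            intro h
            rw [← hb, ← m3] at h
            have := ev_inj _ h
            omega
          rcases Nat.lt_or_gt_of_ne hbu with hlt | hlt
          · have := t4 u hlt j3
            rw [pu, ev_inv_eq hb] at this
            rw [ev_inv_eq t2.symm] at this
            have hne : ev (wprod n A2)⁻¹ v ≠ ev (wprod n A2)⁻¹ u := by
              intro h
              have := ev_inj _ h
              omega
            rw [ev_inv_eq t3.symm] at hne hni
            omega
          · have g1 := hmono b v d3 (by rw [ev_inv_eq s1, ev_inv_eq s2]; omega)
            have g2 := hmono u b hlt (by
              rw [ev_inv_eq s2, ev_inv_eq ((s3 (d+1) (by omega) (by omega)).trans m3)]; omega)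
            omega
        refine ⟨?_, ?_, ?_⟩
        · intro e he
          rcases List.mem_append.1 he with he | he
          · exact m1 e he
          · have : e = d := by simpa using he
            omega
        · rw [hEd, s3 _ (by omega) (by omega), m2]
        · rw [hEd, s3 _ (by omega) (by omega), m3]
    obtain ⟨k1, k2, k3⟩ := claim D [] (by simp)
    rw [← hD] at k3
    have hij : i = j := by
      have := ev_inv_eq k3
      omega
    subst hij
    have hce : CommEquiv R₁ (C ++ D ++ [i]) := by
      have := (commEquiv_move i D k1).append C []
      rw [hD]; simpa using this
    have hred := asc_reduced hA1
    have hce2 := hce.append [] Q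
    rw [List.nil_append, List.nil_append] at hce2
    obtain ⟨q1, q2, q3, q4⟩ := hce2.props hred.1
    have hAsc : Asc n 1 (C ++ D ++ [i] ++ Q) := by
      apply reduced_asc
      refine ⟨q1, ?_⟩
      rw [← q2, ← q3]; exact hred.2
    have e1 : C ++ D ++ [i] ++ Q = C ++ D ++ (i :: Q) := by simp
    have e2 : A ++ [i] ++ Q = A ++ (i :: Q) := by simp
    have hl2 : (C ++ D).length = A.length := by
      have := congrArg List.length hD
      simp at this hl ⊢
      omega
    have hfin := ih (C ++ D) (i :: Q) hl2 (e1 ▸ hAsc) (e2 ▸ hA2)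
      (by rw [← e1, ← e2, ← q2, hp]) (by rw [← e1, ← q2]; exact ha) (by rw [← e1, ← e2, ← q4, hw])
    have := hfin.append [] [i]
    rw [List.nil_append, List.nil_append] at this
    exact Relation.ReflTransGen.trans hce this

theorem exists_completion {n : ℕ} (N : ℕ) : ∀ R : List ℕ, Asc n 1 R → n * n ≤ R.length + N →
    ∃ Q, Asc n 1 (R ++ Q) ∧ Anti (wprod n (R ++ Q)) := by
  induction N with
  | zero =>
    intro R hR hN
    refine ⟨[], by simpa using hR, ?_⟩
    have h1 := (asc_reduced hR).2
    intro p q hpq hq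
    exfalso
    have : len (wprod n R) < n * n := by
      unfold len
      have h3 : (Finset.univ : Finset (Fin n × Fin n)).card = n * n := by simp
      rw [← h3]
      apply Finset.card_lt_card
      rw [Finset.ssubset_iff_subset_ne]
      refine ⟨Finset.subset_univ _, ?_⟩
      intro h
      have : ((⟨q, hq⟩, ⟨q, hq⟩) : Fin n × Fin n) ∈ (Finset.univ : Finset (Fin n × Fin n)) := Finset.mem_univ _
      rw [← h, Finset.mem_filter] at this
      exact absurd this.2.1 (lt_irrefl _)
    omega
  | succ N ih =>
    intro R hR hN
    by_cases hc : ∃ i, 1 ≤ i ∧ i < n ∧ ev (wprod n R) (i-1) < ev (wprod n R) i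
    · obtain ⟨i, i1, i2, i3⟩ := hc
      have hasc : Asc n 1 (R ++ [i]) := by
        apply reduced_asc
        have hr := asc_reduced hR
        refine ⟨?_, ?_⟩
        · intro k hk
          rcases List.mem_append.1 hk with hk | hk
          · exact hr.1 k hk
          · have : k = i := by simpa using hk
            subst this; exact ⟨i1, i2⟩
        · rw [wprod_append, wprod_cons, wprod_nil, mul_one, len_up i1 i2 _ i3, ← hr.2]; simp
      obtain ⟨Q, q1, q2⟩ := ih (R ++ [i]) hasc (by simp; omega)
      exact ⟨i :: Q, by simpa using q1, by simpa using q2⟩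
    · refine ⟨[], by simpa using hR, ?_⟩
      rw [List.append_nil]
      intro p q hpq hq
      induction q with
      | zero => omega
      | succ q ihq =>
        have h1 : ev (wprod n R) (q+1) < ev (wprod n R) q := by
          by_contra h
          apply hc
          refine ⟨q+1, by omega, hq, ?_⟩
          have hne : ev (wprod n R) q ≠ ev (wprod n R) (q+1) := fun h => by have := ev_inj _ h; omega
          simp only [Nat.add_sub_cancel]
          omega
        rcases Nat.lt_or_ge p q with h2 | h2
        · exact h1.trans (ihq h2 (by omega))
        · obtain rfl : p = q := by omega
          exact h1

end BSDist
namespace BSDist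

/-- For reduced words `R₁, R₂` over `{1,…,n−1}`, the
Bott–Samelson distributions `𝔓_{R₁,q}` and `𝔓_{R₂,q}` agree as rational
functions of `q` (i.e. `wt_{R₁}(x)·(1+q)^{L(R₂)} = wt_{R₂}(x)·(1+q)^{L(R₁)}`
in `ℤ[q]` for all `x ∈ S_n`) if and only if `R₁` and `R₂` are
commutation-equivalent. -/
theorem bott_samelson_distribution_eq_iff_commEquiv
    (n : ℕ) (hn : 2 ≤ n) (R₁ R₂ : List ℕ)
    (h₁ : IsReducedWord n R₁) (h₂ : IsReducedWord n R₂) :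
    (∀ x : Equiv.Perm (Fin n),
        wt n R₁ x * (1 + Polynomial.X) ^ R₂.length
          = wt n R₂ x * (1 + Polynomial.X) ^ R₁.length)
      ↔ CommEquiv R₁ R₂ := by
  constructor
  · intro H
    obtain ⟨e1, e2, e3⟩ := wt_start h₁ h₂ H
    obtain ⟨Q, q1, q2⟩ := exists_completion (n * n) R₁ (reduced_asc h₁) (by omega)
    have hr := asc_reduced q1
    have hw : wprod n (R₁ ++ Q) = wprod n (R₂ ++ Q) := by rw [wprod_append, wprod_append, e1]
    refine main_ind R₂ R₁ Q e2 q1 (reduced_asc ⟨?_, ?_⟩) hw q2 (by rw [wt_app, wt_app, e3])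
    · intro k hk
      rcases List.mem_append.1 hk with hk | hk
      · exact h₂.1 k hk
      · exact hr.1 k (by simp [hk])
    · rw [← hw, ← hr.2, List.length_append, List.length_append, e2]
  · intro H x
    obtain ⟨_, _, e1, e2⟩ := H.props h₁.1
    rw [e1, e2]

end BSDist
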